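/- Suppose g is not of type A_{2p}. Let Δ⟨K⟩ = Δ(a_K) = w_K(Δ⁺_{x_K}(-1)) ∪ w_K(-Δ⁺_{x_K}(2)) be the set of roots of the abelian ideal a_K, an upper ideal of the poset (Δ⁺, ≼). Then the set of minimal elements of Δ⟨K⟩ with respect to the root order ≼ is exactly w_K(Π_K(-1)); equivalently, γ ∈ min(Δ⟨K⟩) if and only if w_K^{-1}(γ) ∈ Π_K(-1). -/

import Mathlib

open scoped RealInnerProductSpace

attribute [local instance] Classical.propDecidable

section RootCombinatorics

variable {V : Type*} [NormedAddCommGroup V] [InnerProductSpace ℝ V]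

/-- The Cartan pairing `⟨γ, α∨⟩ = 2 (γ, α) / (α, α)`. -/
noncomputable def cartanPairing (γ α : V) : ℝ := 2 * ⟪γ, α⟫ / ⟪α, α⟫

/-- The coroot `γ∨ = 2 γ / (γ, γ)`. -/
noncomputable def covec (γ : V) : V := (2 / ⟪γ, γ⟫) • γ

/-- The cascade element `x_K = Σ_{β ∈ K} β / (β, β) = ½ Σ_{β ∈ K} β∨`. -/
noncomputable def cascElt (K : Finset V) : V := ∑ β ∈ K, (⟪β, β⟫)⁻¹ • β

/-- The roots of `S` orthogonal to `β`. -/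
noncomputable def orthSub (S : Finset V) (β : V) : Finset V := S.filter fun γ => ⟪γ, β⟫ = 0

/-- One step of the non-orthogonality (connectedness) relation inside `S`. -/
def connRel (S : Finset V) (a b : V) : Prop := a ∈ S ∧ b ∈ S ∧ ⟪a, b⟫ ≠ 0

/-- The irreducible component of the root subsystem `S` containing `γ`. -/
noncomputable def component (S : Finset V) (γ : V) : Finset V :=
  S.filter fun γ' => Relation.ReflTransGen (connRel S) γ γ'

/-- `C` is an irreducible component of the root subsystem `S`. -/
def IsComponent (S C : Finset V) : Prop := ∃ γ ∈ S, C = component S γ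

end RootCombinatorics

/-- The combinatorial data of an irreducible crystallographic root system with a chosen
system of positive roots, base (set of simple roots) and highest root: the combinatorial
skeleton of a finite-dimensional complex simple Lie algebra, with the Killing-form
identification of the Cartan subalgebra and its dual. -/
structure RootSystemCtx (V : Type*) [NormedAddCommGroup V] [InnerProductSpace ℝ V] where
  /-- the set of roots Δ -/
  Δ : Finset V
  /-- the set of simple roots Π -/
  base : Finset V
  /-- the set of positive roots Δ⁺ -/
  Pos : Finset V
  /-- the highest root θ -/
  θ : V
  zero_not_mem : (0 : V) ∉ Δ
  neg_mem : ∀ γ ∈ Δ, -γ ∈ Δ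
  reflect_mem : ∀ α ∈ Δ, ∀ γ ∈ Δ, γ - cartanPairing γ α • α ∈ Δ
  pairing_int : ∀ α ∈ Δ, ∀ γ ∈ Δ, ∃ k : ℤ, cartanPairing γ α = (k : ℝ)
  span_eq : Submodule.span ℝ (Δ : Set V) = ⊤
  base_subset : base ⊆ Pos
  base_indep : LinearIndependent ℝ (fun a : {x // x ∈ base} => (a : V))
  pos_subset : Pos ⊆ Δ
  pos_or_neg : ∀ γ ∈ Δ, γ ∈ Pos ∨ -γ ∈ Pos
  pos_not_neg : ∀ γ ∈ Pos, -γ ∉ Pos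
  pos_coords : ∀ γ ∈ Pos, γ ∈ AddSubmonoid.closure (base : Set V)
  irreducible : ∀ S : Finset V, S ⊆ Δ → S.Nonempty →
    (∀ a ∈ S, ∀ b ∈ Δ, b ∉ S → ⟪a, b⟫ = 0) → S = Δ
  theta_mem : θ ∈ Pos
  theta_highest : ∀ γ ∈ Δ, θ - γ ∈ AddSubmonoid.closure (base : Set V)

namespace RootSystemCtx

variable {V : Type*} [NormedAddCommGroup V] [InnerProductSpace ℝ V]

variable (ctx : RootSystemCtx V)

/-- The root order `γ ≼ γ'` on roots: `γ' - γ` is a nonnegative integral combination of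
simple roots. -/
def rootLE (γ γ' : V) : Prop := γ' - γ ∈ AddSubmonoid.closure (ctx.base : Set V)

/-- `β` is the highest root of the root subsystem `S` (with respect to the ambient positive
system). -/
def IsHighest (S : Finset V) (β : V) : Prop :=
  β ∈ S ∧ β ∈ ctx.Pos ∧ ∀ γ ∈ S, ctx.rootLE γ β

/-- `CascadeMem ctx S β` : the pair (root subsystem `S = Δ⟨i⟩`, its highest root `β = βᵢ`)
occurs in the recursive construction of the Kostant cascade: one starts with `(Δ, θ)`, and the
descendants of `(S, β)` are the pairs `(C, β')` where `C` is an irreducible component of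
`{γ ∈ S | (γ, β) = 0}` and `β'` is the highest root of `C`. -/
inductive CascadeMem : Finset V → V → Prop
  | top : CascadeMem ctx.Δ ctx.θ
  | step {S C : Finset V} {β β' : V} : CascadeMem S β →
      IsComponent (orthSub S β) C → ctx.IsHighest C β' → CascadeMem C β'

/-- `K` is the Kostant cascade of the root system. -/
def IsCascade (K : Finset V) : Prop := ∀ β, β ∈ K ↔ ∃ S, ctx.CascadeMem S β

/-- The Heisenberg subset `H_β = {γ ∈ S ∩ Δ⁺ : (γ, β) > 0}` attached to a cascade pair
`(S, β)`. -/
noncomputable def heis (S : Finset V) (β : V) : Finset V :=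
  S.filter fun γ => γ ∈ ctx.Pos ∧ 0 < ⟪γ, β⟫

/-- A root is long if it has the same length as the highest root. -/
def IsLong (γ : V) : Prop := ⟪γ, γ⟫ = ⟪ctx.θ, ctx.θ⟫

/-- The highest root `θ` is a fundamental weight. -/
def ThetaFundamental : Prop :=
  ∃ α ∈ ctx.base, cartanPairing ctx.θ α = 1 ∧
    ∀ β ∈ ctx.base, β ≠ α → cartanPairing ctx.θ β = 0

/-- `β'` is a descendant of the cascade element `β`. -/
def Desc (β β' : V) : Prop :=
  ∃ S C, ctx.CascadeMem S β ∧ IsComponent (orthSub S β) C ∧ ctx.IsHighest C β'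

/-- The cascade poset order: `β ≤ β'` iff `β` is an iterated descendant of `β'`. -/
def cascLE (β β' : V) : Prop := Relation.ReflTransGen (fun a b => ctx.Desc b a) β β'

/-- A simple reflection of the root system. -/
def IsSimpleReflection (w : V ≃ₗ[ℝ] V) : Prop :=
  ∃ α ∈ ctx.base, ∀ v, w v = v - (2 * ⟪v, α⟫ / ⟪α, α⟫) • α

/-- The Weyl group, generated by the simple reflections. -/
def weylGroup : Subgroup (V ≃ₗ[ℝ] V) := Subgroup.closure {w | ctx.IsSimpleReflection w}

/-- The length of a Weyl group element: the minimal number of simple reflections needed to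
express it. -/
noncomputable def length (w : V ≃ₗ[ℝ] V) : ℕ :=
  sInf {n | ∃ l : List (V ≃ₗ[ℝ] V), l.length = n ∧
    (∀ s ∈ l, ctx.IsSimpleReflection s) ∧ l.prod = w}

/-- The root system is of type `Aₙ` (Cartan matrix characterisation). -/
def IsTypeA (n : ℕ) : Prop :=
  1 ≤ n ∧ ∃ e : Fin n ≃ {x // x ∈ ctx.base}, ∀ i j : Fin n,
    cartanPairing (e i : V) (e j : V) =
      (if i = j then 2 else if i.val + 1 = j.val ∨ j.val + 1 = i.val then -1 else 0)

/-- The root system is of type `Bₙ` (`n ≥ 2`), with the last simple root short. -/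
def IsTypeB (n : ℕ) : Prop :=
  2 ≤ n ∧ ∃ e : Fin n ≃ {x // x ∈ ctx.base}, ∀ i j : Fin n,
    cartanPairing (e i : V) (e j : V) =
      (if i = j then 2
       else if i.val + 2 = n ∧ j.val + 1 = n then -2
       else if i.val + 1 = j.val ∨ j.val + 1 = i.val then -1 else 0)

/-- The root system is of type `Cₙ` (`n ≥ 2`), with the last simple root long. -/
def IsTypeC (n : ℕ) : Prop :=
  2 ≤ n ∧ ∃ e : Fin n ≃ {x // x ∈ ctx.base}, ∀ i j : Fin n,
    cartanPairing (e i : V) (e j : V) =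
      (if i = j then 2
       else if i.val + 1 = n ∧ j.val + 2 = n then -2
       else if i.val + 1 = j.val ∨ j.val + 1 = i.val then -1 else 0)

/-- The root system is of type `G₂` (first simple root short). -/
def IsTypeG2 : Prop :=
  ∃ e : Fin 2 ≃ {x // x ∈ ctx.base},
    cartanPairing (e 0 : V) (e 0 : V) = 2 ∧ cartanPairing (e 1 : V) (e 1 : V) = 2 ∧
    cartanPairing (e 0 : V) (e 1 : V) = -1 ∧ cartanPairing (e 1 : V) (e 0 : V) = -3

/-- The set of roots `Δ(a_z) = w(Δ⁺_z(-1)) ∪ w(-Δ⁺_z(2))` of the abelian ideal attached by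
Kostant's construction to `z` (with `w = w_z`). -/
def idealSet (w : V ≃ₗ[ℝ] V) (x : V) : Set V :=
  {δ | ∃ γ ∈ ctx.Pos, (⟪γ, x⟫ = -1 ∧ δ = w γ) ∨ (⟪γ, x⟫ = 2 ∧ δ = -(w γ))}

end RootSystemCtx

section InnerProductLemmas

variable {V : Type*} [NormedAddCommGroup V] [InnerProductSpace ℝ V]

lemma exists_inner_neg_of_mem_closure {s : Set V} {γ y : V} (hy : y ∈ AddSubmonoid.closure s)
    (h : ⟪γ, y⟫ < 0) : ∃ p ∈ s, ⟪γ, p⟫ < 0 ∧ y - p ∈ AddSubmonoid.closure s := by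
  induction hy using AddSubmonoid.closure_induction with
  | mem p hp => exact ⟨p, hp, h, by simp⟩
  | zero => simp at h
  | add a b ha hb iha ihb =>
    rw [inner_add_right] at h
    by_cases h1 : ⟪γ, a⟫ < 0
    · obtain ⟨p, hp, hlt, hm⟩ := iha h1
      refine ⟨p, hp, hlt, ?_⟩
      rw [add_sub_right_comm]
      exact add_mem hm hb
    · obtain ⟨p, hp, hlt, hm⟩ := ihb (by linarith)
      refine ⟨p, hp, hlt, ?_⟩
      rw [add_sub_assoc]
      exact add_mem ha hm

lemma inner_cascElt (K : Finset V) (γ : V) :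
    ⟪γ, cascElt K⟫ = ∑ β ∈ K, ⟪γ, β⟫ / ⟪β, β⟫ := by
  simp only [cascElt, inner_sum, inner_smul_right]
  exact Finset.sum_congr rfl fun β _ => by ring

/-- Bessel's inequality for a finite set of pairwise orthogonal nonzero vectors. -/
lemma bessel_of_pairwise_orthogonal {K : Finset V} (h0 : ∀ β ∈ K, ⟪β, β⟫ ≠ 0)
    (ho : ∀ a ∈ K, ∀ b ∈ K, a ≠ b → ⟪a, b⟫ = 0) (γ : V) :
    ∑ β ∈ K, ⟪γ, β⟫ ^ 2 / ⟪β, β⟫ ≤ ⟪γ, γ⟫ := by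
  set y : V := ∑ β ∈ K, (⟪γ, β⟫ / ⟪β, β⟫) • β with hy
  have h1 : ⟪γ, y⟫ = ∑ β ∈ K, ⟪γ, β⟫ ^ 2 / ⟪β, β⟫ := by
    simp only [hy, inner_sum, inner_smul_right]
    exact Finset.sum_congr rfl fun β _ => by ring
  have h2 : ∀ a ∈ K, ⟪a, y⟫ = ⟪γ, a⟫ := fun a ha => by
    simp only [hy, inner_sum, inner_smul_right]
    rw [Finset.sum_eq_single a (fun b hb hne => by rw [ho a ha b hb hne.symm, mul_zero])
      (fun h => absurd ha h), div_mul_cancel₀ _ (h0 a ha)]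
  have h3 : ⟪y, y⟫ = ∑ β ∈ K, ⟪γ, β⟫ ^ 2 / ⟪β, β⟫ := by
    conv_lhs => rw [hy, sum_inner]
    refine Finset.sum_congr rfl fun β hβ => ?_
    rw [real_inner_smul_left, h2 β hβ]
    ring
  have h4 : 0 ≤ ⟪γ - y, γ - y⟫ := real_inner_self_nonneg
  rw [real_inner_sub_sub_self, h1, h3] at h4
  linarith

instance connRel_symm (S : Finset V) : Std.Symm (connRel S) :=
  ⟨fun a b h => ⟨h.2.1, h.1, by rw [real_inner_comm]; exact h.2.2⟩⟩

/-- Any two elements of `S` are joined by a chain of pairwise non-orthogonal elements of `S`. -/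
def ConnSet (S : Finset V) : Prop := ∀ a ∈ S, ∀ b ∈ S, Relation.ReflTransGen (connRel S) a b

lemma connSet_component {S : Finset V} (γ : V) : ConnSet (component S γ) := by
  have key : ∀ b, b ∈ component S γ →
      Relation.ReflTransGen (connRel (component S γ)) γ b := by
    intro b hb
    replace hb := (Finset.mem_filter.1 hb).2
    induction hb with
    | refl => exact .refl
    | tail hab hbc ih =>
      exact ih.tail ⟨Finset.mem_filter.2 ⟨hbc.1, hab⟩,
        Finset.mem_filter.2 ⟨hbc.2.1, hab.tail hbc⟩, hbc.2.2⟩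
  intro a ha b hb
  exact (Std.Symm.symm _ _ (key a ha)).trans (key b hb)

lemma component_closed_step {S : Finset V} {γ a b : V} (ha : a ∈ component S γ) (hb : b ∈ S)
    (h : ⟪a, b⟫ ≠ 0) : b ∈ component S γ := by
  obtain ⟨haS, har⟩ := Finset.mem_filter.1 ha
  exact Finset.mem_filter.2 ⟨hb, har.tail ⟨haS, hb, h⟩⟩

lemma ConnSet.subset_component_or_orthogonal {R S : Finset V} (hS : ConnSet S) (hSR : S ⊆ R)
    (γ : V) : S ⊆ component R γ ∨ ∀ a ∈ S, ∀ c ∈ component R γ, ⟪a, c⟫ = 0 := by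
  by_cases h : ∀ a ∈ S, ∀ c ∈ component R γ, ⟪a, c⟫ = 0
  · exact .inr h
  left
  push Not at h
  obtain ⟨a, ha, c, hc, hac⟩ := h
  have haC : a ∈ component R γ :=
    component_closed_step hc (hSR ha) (by rwa [real_inner_comm])
  have hle : connRel S ≤ connRel R := fun x y h => ⟨hSR h.1, hSR h.2.1, h.2.2⟩
  intro b hb
  exact Finset.mem_filter.2 ⟨hSR hb, (Finset.mem_filter.1 haC).2.trans
    (Relation.ReflTransGen.mono hle a b (hS a ha b hb))⟩

end InnerProductLemmas

namespace RootSystemCtx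

variable {V : Type*} [NormedAddCommGroup V] [InnerProductSpace ℝ V]

variable (ctx : RootSystemCtx V)

lemma inner_self_pos {γ : V} (h : γ ∈ ctx.Δ) : 0 < ⟪γ, γ⟫ :=
  real_inner_self_pos.2 fun h0 => ctx.zero_not_mem (h0 ▸ h)

lemma sub_mem_of_inner_pos {a b : V} (ha : a ∈ ctx.Δ) (hb : b ∈ ctx.Δ) (h : 0 < ⟪a, b⟫)
    (hne : a ≠ b) : a - b ∈ ctx.Δ := by
  have hpa := ctx.inner_self_pos ha
  have hpb := ctx.inner_self_pos hb
  obtain ⟨k, hk⟩ := ctx.pairing_int b hb a ha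
  obtain ⟨l, hl⟩ := ctx.pairing_int a ha b hb
  have r1 := ctx.reflect_mem b hb a ha
  have r2 := ctx.reflect_mem a ha b hb
  rw [hk] at r1
  rw [hl] at r2
  simp only [cartanPairing] at hk hl
  rw [real_inner_comm] at hl
  have hk0 : (0 : ℝ) < k := by rw [← hk]; positivity
  have hl0 : (0 : ℝ) < l := by rw [← hl]; positivity
  have hk1 : 1 ≤ k := by exact_mod_cast hk0
  have hl1 : 1 ≤ l := by exact_mod_cast hl0
  rcases eq_or_lt_of_le hk1 with rfl | hk2
  · simpa using r1
  rcases eq_or_lt_of_le hl1 with rfl | hl2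
  · simpa using ctx.neg_mem _ r2
  exfalso
  have hk2' : (2 : ℝ) ≤ k := by exact_mod_cast hk2
  have hl2' : (2 : ℝ) ≤ l := by exact_mod_cast hl2
  rw [← hk, le_div_iff₀ hpb] at hk2'
  rw [← hl, le_div_iff₀ hpa] at hl2'
  have h0 : ⟪a - b, a - b⟫ ≤ 0 := by
    rw [real_inner_sub_sub_self]
    linarith
  exact hne (sub_eq_zero.1 (real_inner_self_nonpos.1 h0))

lemma add_mem_of_inner_neg {a b : V} (ha : a ∈ ctx.Δ) (hb : b ∈ ctx.Δ) (h : ⟪a, b⟫ < 0)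
    (hne : a + b ≠ 0) : a + b ∈ ctx.Δ := by
  have := ctx.sub_mem_of_inner_pos ha (ctx.neg_mem b hb) (by rw [inner_neg_right]; linarith)
    (fun h => hne (by rw [h]; simp))
  simpa using this

lemma exists_height : ∃ ht : V →ₗ[ℝ] ℝ, ∀ b ∈ ctx.base, ht b = 1 := by
  let B := Module.Basis.extend ctx.base_indep.linearIndepOn_id
  refine ⟨B.constr ℝ fun _ => (1 : ℝ), fun b hb => ?_⟩
  have hb' : b ∈ ctx.base_indep.linearIndepOn_id.extend (Set.subset_univ _) :=
    Module.Basis.subset_extend _ ⟨⟨b, hb⟩, rfl⟩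
  have := B.constr_basis ℝ (fun _ => (1 : ℝ)) ⟨b, hb'⟩
  rwa [Module.Basis.extend_apply_self] at this

/-- The height: the linear functional equal to `1` on every simple root. -/
noncomputable def height : V →ₗ[ℝ] ℝ := ctx.exists_height.choose

lemma height_base {b : V} (hb : b ∈ ctx.base) : ctx.height b = 1 :=
  ctx.exists_height.choose_spec b hb

lemma height_of_mem_closure {y : V} (hy : y ∈ AddSubmonoid.closure (ctx.base : Set V)) :
    y = 0 ∨ 1 ≤ ctx.height y := by
  induction hy using AddSubmonoid.closure_induction with
  | mem b hb => exact .inr (ctx.height_base hb).ge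
  | zero => exact .inl rfl
  | add a b _ _ iha ihb =>
    rw [map_add]
    rcases iha with rfl | ha <;> rcases ihb with rfl | hb
    · simp
    · simp [hb]
    · simp [ha]
    · right; linarith

lemma height_nonneg {y : V} (hy : y ∈ AddSubmonoid.closure (ctx.base : Set V)) :
    0 ≤ ctx.height y := by
  rcases ctx.height_of_mem_closure hy with rfl | h
  · simp
  · linarith

lemma ne_zero_of_pos {γ : V} (h : γ ∈ ctx.Pos) : γ ≠ 0 :=
  fun h0 => ctx.zero_not_mem (h0 ▸ ctx.pos_subset h)

lemma one_le_height {γ : V} (h : γ ∈ ctx.Pos) : 1 ≤ ctx.height γ :=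
  (ctx.height_of_mem_closure (ctx.pos_coords γ h)).resolve_left (ctx.ne_zero_of_pos h)

lemma pos_of_height_nonneg {γ : V} (h : γ ∈ ctx.Δ) (h' : 0 ≤ ctx.height γ) : γ ∈ ctx.Pos := by
  refine (ctx.pos_or_neg γ h).resolve_right fun hn => ?_
  have := ctx.one_le_height hn
  rw [map_neg] at this
  linarith

lemma rootLE_antisymm {a b : V} (hab : ctx.rootLE a b) (hba : ctx.rootLE b a) : a = b := by
  rcases ctx.height_of_mem_closure hab with h | h
  · exact (sub_eq_zero.1 h).symm
  · have := ctx.height_nonneg hba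
    rw [map_sub] at h this
    linarith

/-- A symmetric set of roots containing every root that is a sum of two of its elements. -/
structure ClosedSub (C : Finset V) : Prop where
  subset : C ⊆ ctx.Δ
  neg : ∀ a ∈ C, -a ∈ C
  add : ∀ a ∈ C, ∀ b ∈ C, a + b ∈ ctx.Δ → a + b ∈ C

variable {ctx}

lemma ClosedSub.sub {C : Finset V} (hC : ctx.ClosedSub C) {a b : V} (ha : a ∈ C) (hb : b ∈ C)
    (h : a - b ∈ ctx.Δ) : a - b ∈ C := by
  rw [sub_eq_add_neg] at h ⊢
  exact hC.add a ha _ (hC.neg b hb) h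

lemma ClosedSub.add_mem {C : Finset V} (hC : ctx.ClosedSub C) {a b : V} (ha : a ∈ C)
    (hb : b ∈ C) (hap : a ∈ ctx.Pos) (hbp : b ∈ ctx.Pos) (h : ⟪a, b⟫ < 0) : a + b ∈ C := by
  refine hC.add a ha b hb (ctx.add_mem_of_inner_neg (hC.subset ha) (hC.subset hb) h fun h0 => ?_)
  have h1 := ctx.one_le_height hap
  have h2 := ctx.one_le_height hbp
  have h3 := congrArg ctx.height h0
  rw [map_add, map_zero] at h3
  linarith

/-- For non-orthogonal distinct elements with positive inner product, one of the two differences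
is positive. -/
lemma ClosedSub.sub_pos_or {C : Finset V} (hC : ctx.ClosedSub C) {a b : V} (ha : a ∈ C)
    (hb : b ∈ C) (h : 0 < ⟪a, b⟫) (hne : a ≠ b) :
    (a - b ∈ C ∧ a - b ∈ ctx.Pos) ∨ (b - a ∈ C ∧ b - a ∈ ctx.Pos) := by
  have hd := ctx.sub_mem_of_inner_pos (hC.subset ha) (hC.subset hb) h hne
  have hdC := hC.sub ha hb hd
  rcases ctx.pos_or_neg _ hd with hp | hp
  · exact .inl ⟨hdC, hp⟩
  · have hdC' := hC.neg _ hdC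
    rw [neg_sub] at hp hdC'
    exact .inr ⟨hdC', hp⟩

lemma closedSub_roots : ctx.ClosedSub ctx.Δ :=
  ⟨subset_rfl, ctx.neg_mem, fun _ _ _ _ h => h⟩

variable (ctx) in
/-- The monoid generated by the positive roots in `C`. -/
def posCone (C : Finset V) : AddSubmonoid V := AddSubmonoid.closure {p | p ∈ C ∧ p ∈ ctx.Pos}

lemma mem_posCone {C : Finset V} {p : V} (h : p ∈ C) (hp : p ∈ ctx.Pos) : p ∈ ctx.posCone C :=
  AddSubmonoid.subset_closure ⟨h, hp⟩

lemma posCone_le (C : Finset V) :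
    ctx.posCone C ≤ AddSubmonoid.closure (ctx.base : Set V) :=
  AddSubmonoid.closure_le.2 fun p hp => ctx.pos_coords p hp.2

lemma ClosedSub.exists_pos_add {C : Finset V} (hC : ctx.ClosedSub C) {β γ : V} (hβ : β ∈ C)
    (hγ : γ ∈ C) (hγp : γ ∈ ctx.Pos) (hne : γ ≠ β) (hy : β - γ ∈ ctx.posCone C) :
    ∃ q ∈ C, q ∈ ctx.Pos ∧ γ + q ∈ C ∧ β - (γ + q) ∈ ctx.posCone C := by
  by_cases h : ⟪γ, β - γ⟫ < 0
  · obtain ⟨q, ⟨hqC, hqp⟩, hlt, hm⟩ := exists_inner_neg_of_mem_closure hy h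
    refine ⟨q, hqC, hqp, hC.add_mem hγ hqC hγp hqp hlt, ?_⟩
    rwa [← sub_sub]
  · rw [inner_sub_right, not_lt] at h
    have hpos := ctx.inner_self_pos (hC.subset hγ)
    have hd := ctx.sub_mem_of_inner_pos (hC.subset hβ) (hC.subset hγ)
      (by rw [real_inner_comm]; linarith) hne.symm
    refine ⟨β - γ, hC.sub hβ hγ hd,
      ctx.pos_of_height_nonneg hd (ctx.height_nonneg (posCone_le C hy)), ?_, ?_⟩
    · rwa [add_sub_cancel]
    · rw [add_sub_cancel, sub_self]
      exact zero_mem _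

lemma ClosedSub.sub_add_mem_posCone {C : Finset V} (hC : ctx.ClosedSub C) {β : V} (hβ : β ∈ C)
    (hmax : ∀ p ∈ C, p ∈ ctx.Pos → β + p ∉ C) {γ r : V} (hγ : γ ∈ C) (hγp : γ ∈ ctx.Pos)
    (hγβ : β - γ ∈ ctx.posCone C) (hr : r ∈ C) (hrp : r ∈ ctx.Pos) (hγr : γ + r ∈ C) :
    β - (γ + r) ∈ ctx.posCone C := by
  obtain ⟨n, hn⟩ := exists_nat_ge (ctx.height (β - γ))
  induction n generalizing γ r with
  | zero =>
    exfalso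
    have hne : γ ≠ β := fun h => hmax r hr hrp (h ▸ hγr)
    obtain ⟨q, hq, hqp, hγq, hqβ⟩ := hC.exists_pos_add hβ hγ hγp hne hγβ
    have h1 := ctx.height_nonneg (posCone_le C hqβ)
    have h2 := ctx.one_le_height hqp
    rw [← sub_sub, map_sub] at h1
    push_cast at hn
    linarith
  | succ n ih =>
    have hne : γ ≠ β := fun h => hmax r hr hrp (h ▸ hγr)
    obtain ⟨q, hq, hqp, hγq, hqβ⟩ := hC.exists_pos_add hβ hγ hγp hne hγβ
    have hγqp : γ + q ∈ ctx.Pos := by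
      refine ctx.pos_of_height_nonneg (hC.subset hγq) ?_
      have h1 := ctx.one_le_height hγp
      have h2 := ctx.one_le_height hqp
      rw [map_add]
      linarith
    have hγrp : γ + r ∈ ctx.Pos := by
      refine ctx.pos_of_height_nonneg (hC.subset hγr) ?_
      have h1 := ctx.one_le_height hγp
      have h2 := ctx.one_le_height hrp
      rw [map_add]
      linarith
    have hstep : ∀ {s : V}, s ∈ C → s ∈ ctx.Pos → γ + q + s ∈ C →
        β - (γ + q + s) ∈ ctx.posCone C := fun {s} hs hsp hsum => by
      refine ih hγq hγqp hqβ hs hsp hsum ?_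
      have h2 := ctx.one_le_height hqp
      rw [← sub_sub, map_sub]
      push_cast at hn
      linarith
    by_cases hqr : q = r
    · exact hqr ▸ hqβ
    have hdiff : (q - r ∈ C ∧ q - r ∈ ctx.Pos) ∨ (r - q ∈ C ∧ r - q ∈ ctx.Pos) →
        β - (γ + r) ∈ ctx.posCone C := by
      rintro (⟨h, hp⟩ | ⟨h, hp⟩)
      · have := AddMemClass.add_mem hqβ (mem_posCone h hp)
        rwa [show β - (γ + q) + (q - r) = β - (γ + r) by abel] at this
      · have hs : γ + q + (r - q) = γ + r := by abel
        have := hstep h hp (by rwa [hs])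
        rwa [hs] at this
    have hsum : γ + q + r ∈ C → β - (γ + r) ∈ ctx.posCone C := fun h => by
      have := AddMemClass.add_mem (hstep hr hrp h) (mem_posCone hq hqp)
      rwa [show β - (γ + q + r) + q = β - (γ + r) by abel] at this
    by_cases h1 : 0 < ⟪q, r⟫
    · exact hdiff (hC.sub_pos_or hq hr h1 hqr)
    by_cases h2 : ⟪γ + q, r⟫ < 0
    · exact hsum (hC.add_mem hγq hr hγqp hrp h2)
    by_cases h3 : ⟪γ + r, q⟫ < 0
    · refine hsum ?_
      rw [add_right_comm]
      exact hC.add_mem hγr hq hγrp hqp h3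
    have hpos : 0 < ⟪γ + q, γ + r⟫ := by
      have h0 := ctx.inner_self_pos (hC.subset hγ)
      have e1 := real_inner_comm q r
      have e2 := real_inner_comm γ q
      simp only [inner_add_left, inner_add_right] at h2 h3 ⊢
      linarith
    have hne' : γ + q ≠ γ + r := fun h => hqr (add_left_cancel h)
    refine hdiff ?_
    have := hC.sub_pos_or hγq hγr hpos hne'
    rwa [add_sub_add_left_eq_sub, add_sub_add_left_eq_sub] at this

lemma ClosedSub.exists_isHighest {C : Finset V} (hC : ctx.ClosedSub C) (hconn : ConnSet C)
    (hne : C.Nonempty) : ∃ β, ctx.IsHighest C β := by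
  obtain ⟨c, hc⟩ := hne
  have hP : (C.filter (· ∈ ctx.Pos)).Nonempty := by
    rcases ctx.pos_or_neg c (hC.subset hc) with h | h
    · exact ⟨c, Finset.mem_filter.2 ⟨hc, h⟩⟩
    · exact ⟨-c, Finset.mem_filter.2 ⟨hC.neg c hc, h⟩⟩
  obtain ⟨β, hβm, hβmax⟩ := Finset.exists_max_image _ ctx.height hP
  obtain ⟨hβ, hβp⟩ := Finset.mem_filter.1 hβm
  have hmax : ∀ p ∈ C, p ∈ ctx.Pos → β + p ∉ C := fun p _ hp hs => by
    have h1 := ctx.one_le_height hp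
    have h2 := ctx.one_le_height hβp
    have h3 : β + p ∈ ctx.Pos :=
      ctx.pos_of_height_nonneg (hC.subset hs) (by rw [map_add]; linarith)
    have h4 := hβmax _ (Finset.mem_filter.2 ⟨hs, h3⟩)
    rw [map_add] at h4
    linarith
  have core : ∀ γ ∈ C, γ ∈ ctx.Pos → β - γ ∈ ctx.posCone C → ∀ p ∈ C, p ∈ ctx.Pos →
      ⟪γ, p⟫ ≠ 0 → β - p ∈ ctx.posCone C := by
    intro γ hγ hγp hγβ p hp hpp hin
    rcases lt_or_gt_of_ne hin with h | h
    · have h1 := hC.add_mem hγ hp hγp hpp h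
      have := AddMemClass.add_mem (hC.sub_add_mem_posCone hβ hmax hγ hγp hγβ hp hpp h1)
        (mem_posCone hγ hγp)
      rwa [show β - (γ + p) + γ = β - p by abel] at this
    · by_cases he : γ = p
      · exact he ▸ hγβ
      rcases hC.sub_pos_or hγ hp h he with ⟨h1, h2⟩ | ⟨h1, h2⟩
      · have := AddMemClass.add_mem hγβ (mem_posCone h1 h2)
        rwa [sub_add_sub_cancel] at this
      · have := hC.sub_add_mem_posCone hβ hmax hγ hγp hγβ h1 h2 (by rwa [add_sub_cancel])
        rwa [add_sub_cancel] at this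
  have reach : ∀ δ, Relation.ReflTransGen (connRel C) β δ →
      ∃ γ ∈ C, γ ∈ ctx.Pos ∧ β - γ ∈ ctx.posCone C ∧ (δ = γ ∨ δ = -γ) := by
    intro δ h
    induction h with
    | refl => exact ⟨β, hβ, hβp, by simp [zero_mem], .inl rfl⟩
    | @tail a b _ hst ih =>
      obtain ⟨γ, hγ, hγp, hγβ, hδ⟩ := ih
      have hin : ⟪γ, b⟫ ≠ 0 := by
        rcases hδ with rfl | rfl
        · exact hst.2.2
        · simpa using hst.2.2
      rcases ctx.pos_or_neg b (hC.subset hst.2.1) with hp | hp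
      · exact ⟨b, hst.2.1, hp, core γ hγ hγp hγβ b hst.2.1 hp hin, .inl rfl⟩
      · exact ⟨-b, hC.neg b hst.2.1, hp,
          core γ hγ hγp hγβ _ (hC.neg b hst.2.1) hp (by simpa using hin), .inr (by simp)⟩
  refine ⟨β, hβ, hβp, fun δ hδ => ?_⟩
  obtain ⟨γ, hγ, hγp, hγβ, rfl | rfl⟩ := reach δ (hconn β hβ δ hδ)
  · exact posCone_le C hγβ
  · have := AddMemClass.add_mem (AddMemClass.add_mem (posCone_le C hγβ) (ctx.pos_coords γ hγp))
      (ctx.pos_coords γ hγp)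
    rwa [show β - γ + γ + γ = β - -γ by abel] at this

lemma ClosedSub.component_orthSub {S : Finset V} (hS : ctx.ClosedSub S) (β γ : V) :
    ctx.ClosedSub (component (orthSub S β) γ) := by
  have hsub : component (orthSub S β) γ ⊆ orthSub S β := Finset.filter_subset _ _
  have hsubS : orthSub S β ⊆ S := Finset.filter_subset _ _
  refine ⟨(hsub.trans hsubS).trans hS.subset, fun a ha => ?_, fun a ha b hb hab => ?_⟩
  · obtain ⟨haS, hao⟩ := Finset.mem_filter.1 (hsub ha)
    refine component_closed_step ha
      (Finset.mem_filter.2 ⟨hS.neg a haS, by rw [inner_neg_left, hao, neg_zero]⟩) ?_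
    rw [inner_neg_right]
    exact neg_ne_zero.2 (ctx.inner_self_pos (hS.subset haS)).ne'
  · obtain ⟨haS, hao⟩ := Finset.mem_filter.1 (hsub ha)
    obtain ⟨hbS, hbo⟩ := Finset.mem_filter.1 (hsub hb)
    have hm : a + b ∈ orthSub S β :=
      Finset.mem_filter.2 ⟨hS.add a haS b hbS hab, by rw [inner_add_left, hao, hbo, add_zero]⟩
    by_cases h : ⟪a, a + b⟫ = 0
    · refine component_closed_step hb hm fun h' => (ctx.inner_self_pos hab).ne' ?_
      rw [inner_add_left, h, h', add_zero]
    · exact component_closed_step ha hm h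

lemma connSet_roots : ConnSet ctx.Δ := by
  intro a ha b hb
  have : component ctx.Δ a = ctx.Δ := by
    refine ctx.irreducible _ (Finset.filter_subset _ _)
      ⟨a, Finset.mem_filter.2 ⟨ha, .refl⟩⟩ fun c hc d hd hdn => ?_
    by_contra h
    exact hdn (component_closed_step hc hd h)
  rw [← this] at hb
  exact (Finset.mem_filter.1 hb).2

namespace CascadeMem

lemma closedSub {S : Finset V} {β : V} (h : ctx.CascadeMem S β) : ctx.ClosedSub S := by
  induction h with
  | top => exact closedSub_roots
  | step _ hC _ ih =>
    obtain ⟨γ, -, rfl⟩ := hC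
    exact ih.component_orthSub _ γ

lemma connSet {S : Finset V} {β : V} (h : ctx.CascadeMem S β) : ConnSet S := by
  cases h with
  | top => exact connSet_roots
  | step _ hC _ =>
    obtain ⟨γ, -, rfl⟩ := hC
    exact connSet_component γ

lemma isHighest {S : Finset V} {β : V} (h : ctx.CascadeMem S β) : ctx.IsHighest S β := by
  cases h with
  | top => exact ⟨ctx.pos_subset ctx.theta_mem, ctx.theta_mem, ctx.theta_highest⟩
  | step _ _ hH => exact hH

lemma exists_inner_pos {S : Finset V} {β γ : V} (h : ctx.CascadeMem S β) (hγ : γ ∈ S)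
    (hγp : γ ∈ ctx.Pos) :
    ∃ S' β', ctx.CascadeMem S' β' ∧ 0 < ⟪γ, β'⟫ ∧ ctx.rootLE γ β' := by
  induction hn : S.card using Nat.strong_induction_on generalizing S β with
  | _ n ih =>
  obtain ⟨hβ, hβp, hhigh⟩ := h.isHighest
  have hC := h.closedSub
  rcases lt_trichotomy 0 ⟪γ, β⟫ with hlt | heq | hgt
  · exact ⟨S, β, h, hlt, hhigh γ hγ⟩
  · have hγo : γ ∈ orthSub S β := Finset.mem_filter.2 ⟨hγ, heq.symm⟩
    obtain ⟨β', hβ'⟩ := (hC.component_orthSub β γ).exists_isHighest (connSet_component γ)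
      ⟨γ, Finset.mem_filter.2 ⟨hγo, .refl⟩⟩
    refine ih _ ?_ (h.step ⟨γ, hγo, rfl⟩ hβ') (Finset.mem_filter.2 ⟨hγo, .refl⟩) rfl
    rw [← hn]
    refine Finset.card_lt_card ((Finset.ssubset_iff_of_subset
      ((Finset.filter_subset _ _).trans (Finset.filter_subset _ _))).2 ⟨β, hβ, fun hm => ?_⟩)
    have := (Finset.mem_filter.1 (Finset.mem_filter.1 hm).1).2
    exact (ctx.inner_self_pos (hC.subset hβ)).ne' this
  · exfalso
    have h1 := ctx.height_nonneg (hhigh _ (hC.add_mem hγ hβ hγp hβp hgt))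
    have h2 := ctx.one_le_height hγp
    rw [map_sub, map_add] at h1
    linarith

/-- Two cascade pairs coincide, or one lies below the other, or they are orthogonal. -/
lemma relative_position {S S' : Finset V} {β β' : V} (h : ctx.CascadeMem S β)
    (h' : ctx.CascadeMem S' β') :
    (S = S' ∧ β = β') ∨ S' ⊆ orthSub S β ∨ S ⊆ orthSub S' β' ∨
      ∀ a ∈ S, ∀ b ∈ S', ⟪a, b⟫ = 0 := by
  have hsub : ∀ {S C : Finset V} {β : V}, IsComponent (orthSub S β) C → C ⊆ orthSub S β := by
    rintro S C β ⟨γ, -, rfl⟩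
    exact Finset.filter_subset _ _
  have hsub' : ∀ {S : Finset V} {β : V}, orthSub S β ⊆ S := by
    intro S β
    exact Finset.filter_subset _ _
  have not_sub : ∀ {S : Finset V} {β : V}, ctx.CascadeMem S β → ¬ ctx.Δ ⊆ orthSub S β :=
    fun {S β} h hs => by
      have hβ := h.closedSub.subset h.isHighest.1
      exact (ctx.inner_self_pos hβ).ne' (Finset.mem_filter.1 (hs hβ)).2
  have from_top : ∀ {T : Finset V} {β₁ : V}, ctx.CascadeMem T β₁ →
      (T = ctx.Δ ∧ β₁ = ctx.θ) ∨ T ⊆ orthSub ctx.Δ ctx.θ := fun {T β₁} hT => by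
    induction hT with
    | top => exact .inl ⟨rfl, rfl⟩
    | step _ hC _ ih =>
      rcases ih with ⟨rfl, rfl⟩ | ih
      · exact .inr (hsub hC)
      · exact .inr (((hsub hC).trans hsub').trans ih)
  induction h generalizing S' β' with
  | top =>
    rcases from_top h' with ⟨rfl, rfl⟩ | h
    · exact .inl ⟨rfl, rfl⟩
    · exact .inr (.inl h)
  | @step S₀ C β₀ β₁ h₀ hC hH ihX =>
    induction h' with
    | top =>
      exact .inr (.inr (.inl ((from_top (h₀.step hC hH)).resolve_left fun h =>
        not_sub h₀ (h.1 ▸ hsub hC))))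
    | @step T₀ D β₂ β₃ k₀ hD kH ihY =>
      rcases ihY with ⟨rfl, rfl⟩ | hy | hy | hy
      · exact .inr (.inl (hsub hD))
      · exact .inr (.inl (((hsub hD).trans hsub').trans hy))
      · rcases ihX (k₀.step hD kH) with ⟨rfl, rfl⟩ | hx | hx | hx
        · exact .inr (.inr (.inl (hsub hC)))
        · obtain ⟨γ, -, hγ⟩ := hC
          obtain ⟨δ, -, hδ⟩ := hD
          have c1 : ConnSet C := hγ ▸ connSet_component γ
          have c2 : ConnSet D := hδ ▸ connSet_component δ
          rcases c1.subset_component_or_orthogonal hy δ with h1 | h1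
          · rcases c2.subset_component_or_orthogonal hx γ with h2 | h2
            · rw [← hδ] at h1
              rw [← hγ] at h2
              have he : C = D := h1.antisymm h2
              subst he
              exact .inl ⟨rfl, ctx.rootLE_antisymm (kH.2.2 _ hH.1) (hH.2.2 _ kH.1)⟩
            · rw [← hγ] at h2
              exact .inr (.inr (.inr fun a ha b hb => by rw [real_inner_comm]; exact h2 b hb a ha))
          · rw [← hδ] at h1
            exact .inr (.inr (.inr h1))
        · exact .inr (.inr (.inl (((hsub hC).trans hsub').trans hx)))
        · exact .inr (.inr (.inr fun a ha => hx a (hsub' (hsub hC ha))))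
      · exact .inr (.inr (.inr fun a ha b hb => hy a ha b (hsub' (hsub hD hb))))

lemma orthogonal {S S' : Finset V} {β β' : V} (h : ctx.CascadeMem S β)
    (h' : ctx.CascadeMem S' β') (hne : β ≠ β') : ⟪β, β'⟫ = 0 := by
  rcases h.relative_position h' with ⟨-, he⟩ | hs | hs | ho
  · exact absurd he hne
  · rw [real_inner_comm]
    exact (Finset.mem_filter.1 (hs h'.isHighest.1)).2
  · exact (Finset.mem_filter.1 (hs h.isHighest.1)).2
  · exact ho β h.isHighest.1 β' h'.isHighest.1

end CascadeMem

namespace IsCascade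

variable {K : Finset V}

lemma subset_roots (hK : ctx.IsCascade K) : K ⊆ ctx.Δ := fun β hβ => by
  obtain ⟨S, hS⟩ := (hK β).1 hβ
  exact hS.closedSub.subset hS.isHighest.1

lemma orthogonal (hK : ctx.IsCascade K) : ∀ a ∈ K, ∀ b ∈ K, a ≠ b → ⟪a, b⟫ = 0 := by
  intro a ha b hb hne
  obtain ⟨S, hS⟩ := (hK a).1 ha
  obtain ⟨T, hT⟩ := (hK b).1 hb
  exact hS.orthogonal hT hne

lemma exists_inner_pos (hK : ctx.IsCascade K) {γ : V} (hγ : γ ∈ ctx.Pos) :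
    ∃ β ∈ K, 0 < ⟪γ, β⟫ ∧ ctx.rootLE γ β := by
  obtain ⟨S, β, h, h1, h2⟩ := CascadeMem.top.exists_inner_pos (ctx.pos_subset hγ) hγ
  exact ⟨β, (hK β).2 ⟨S, h⟩, h1, h2⟩

lemma inner_self_cascElt (hK : ctx.IsCascade K) {β : V} (hβ : β ∈ K) :
    ⟪β, cascElt K⟫ = 1 := by
  rw [inner_cascElt, Finset.sum_eq_single β
    (fun b hb hne => by rw [hK.orthogonal β hβ b hb hne.symm, zero_div])
    (fun h => absurd hβ h), div_self (ctx.inner_self_pos (hK.subset_roots hβ)).ne']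

lemma theta_mem (hK : ctx.IsCascade K) : ctx.θ ∈ K := (hK _).2 ⟨_, .top⟩

lemma sum_abs_cartanPairing_le (hK : ctx.IsCascade K) {γ : V} (hγ : γ ∈ ctx.Δ) :
    ∑ β ∈ K, |cartanPairing γ β| ≤ 4 := by
  have hpos := ctx.inner_self_pos hγ
  have hB := bessel_of_pairwise_orthogonal
    (fun β hβ => (ctx.inner_self_pos (hK.subset_roots hβ)).ne') hK.orthogonal γ
  have hle : ∀ β ∈ K, |cartanPairing γ β| ≤ 4 / ⟪γ, γ⟫ * (⟪γ, β⟫ ^ 2 / ⟪β, β⟫) := by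
    intro β hβ
    have hβp := ctx.inner_self_pos (hK.subset_roots hβ)
    obtain ⟨l, hl⟩ := ctx.pairing_int γ hγ β (hK.subset_roots hβ)
    have e : 4 / ⟪γ, γ⟫ * (⟪γ, β⟫ ^ 2 / ⟪β, β⟫) = cartanPairing γ β * l := by
      rw [← hl]
      simp only [cartanPairing]
      rw [real_inner_comm γ β]
      field_simp
      ring
    have hnn : 0 ≤ cartanPairing γ β * l := by rw [← e]; positivity
    rw [e, ← abs_of_nonneg hnn, abs_mul]
    by_cases h0 : l = 0
    · have : ⟪γ, β⟫ = 0 := by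
        rw [h0] at hl
        simp only [cartanPairing, Int.cast_zero, div_eq_zero_iff, hpos.ne', or_false] at hl
        rw [real_inner_comm]
        linarith
      simp [cartanPairing, this]
    · have : (1 : ℝ) ≤ |(l : ℝ)| := by exact_mod_cast Int.one_le_abs h0
      exact le_mul_of_one_le_right (abs_nonneg _) this
  calc ∑ β ∈ K, |cartanPairing γ β|
      ≤ ∑ β ∈ K, 4 / ⟪γ, γ⟫ * (⟪γ, β⟫ ^ 2 / ⟪β, β⟫) := Finset.sum_le_sum hle
    _ = 4 / ⟪γ, γ⟫ * ∑ β ∈ K, ⟪γ, β⟫ ^ 2 / ⟪β, β⟫ := by rw [Finset.mul_sum]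
    _ ≤ 4 / ⟪γ, γ⟫ * ⟪γ, γ⟫ := by gcongr
    _ = 4 := div_mul_cancel₀ _ hpos.ne'

lemma two_mul_inner_cascElt (γ : V) :
    2 * ⟪γ, cascElt K⟫ = ∑ β ∈ K, cartanPairing γ β := by
  rw [inner_cascElt, Finset.mul_sum]
  exact Finset.sum_congr rfl fun β _ => by rw [cartanPairing, mul_div_assoc]

/-- The values of positive roots on the cascade element are half-integers in `[-1, 2]`. -/
lemma exists_two_mul_inner_eq (hK : ctx.IsCascade K) {γ : V} (hγ : γ ∈ ctx.Pos) :
    ∃ n : ℤ, 2 * ⟪γ, cascElt K⟫ = n ∧ -2 ≤ n ∧ n ≤ 4 := by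
  have hγΔ := ctx.pos_subset hγ
  have hint : ∀ β ∈ K, ∃ k : ℤ, cartanPairing γ β = k := fun β hβ =>
    ctx.pairing_int β (hK.subset_roots hβ) γ hγΔ
  choose! k hk using hint
  have hsum : 2 * ⟪γ, cascElt K⟫ = ((∑ β ∈ K, k β : ℤ) : ℝ) := by
    rw [two_mul_inner_cascElt, Int.cast_sum]
    exact Finset.sum_congr rfl hk
  have habs : ∑ β ∈ K, |k β| ≤ 4 := by
    have h := hK.sum_abs_cartanPairing_le hγΔ
    rw [Finset.sum_congr rfl fun β hβ => by rw [hk β hβ]] at h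
    exact_mod_cast h
  obtain ⟨β, hβ, hin, -⟩ := hK.exists_inner_pos hγ
  have hkβ : 1 ≤ k β := by
    have h1 := hk β hβ
    have h2 := ctx.inner_self_pos (hK.subset_roots hβ)
    have : (0 : ℝ) < k β := by rw [← h1, cartanPairing]; positivity
    exact_mod_cast this
  refine ⟨_, hsum, ?_, (Finset.sum_le_sum fun β _ => le_abs_self (k β)).trans habs⟩
  have hrest : -∑ b ∈ K.erase β, |k b| ≤ ∑ b ∈ K.erase β, k b := by
    rw [← Finset.sum_neg_distrib]
    exact Finset.sum_le_sum fun b _ => neg_abs_le (k b)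
  rw [← Finset.add_sum_erase K _ hβ] at habs ⊢
  have := le_abs_self (k β)
  linarith

end IsCascade

lemma weylGroup_mem_roots_iff {w : V ≃ₗ[ℝ] V} (hw : w ∈ ctx.weylGroup) (γ : V) :
    w γ ∈ ctx.Δ ↔ γ ∈ ctx.Δ := by
  induction hw using Subgroup.closure_induction generalizing γ with
  | mem s hs =>
    obtain ⟨α, hα, hs⟩ := hs
    have hαΔ := ctx.pos_subset (ctx.base_subset hα)
    have hne := (ctx.inner_self_pos hαΔ).ne'
    have key : ∀ v ∈ ctx.Δ, s v ∈ ctx.Δ := fun v hv => by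
      rw [hs v]
      exact ctx.reflect_mem α hαΔ v hv
    refine ⟨fun h => ?_, key γ⟩
    have hss : s (s γ) = γ := by
      rw [hs (s γ), hs γ, inner_sub_left, real_inner_smul_left, div_mul_cancel₀ _ hne, sub_sub,
        ← add_smul, ← add_div, show 2 * ⟪γ, α⟫ + 2 * (⟪γ, α⟫ - 2 * ⟪γ, α⟫) = 0 by ring,
        zero_div, zero_smul, sub_zero]
    exact hss ▸ key _ h
  | one => rfl
  | mul a b _ _ iha ihb => exact (iha (b γ)).trans (ihb γ)
  | inv a _ iha =>
    rw [← iha (a⁻¹ γ), ← LinearEquiv.mul_apply, mul_inv_cancel]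
    rfl

lemma exists_base_sub_pos {γ : V} (hγ : γ ∈ ctx.Pos) (hb : γ ∉ ctx.base) :
    ∃ α ∈ ctx.base, γ - α ∈ ctx.Pos := by
  have hγΔ := ctx.pos_subset hγ
  obtain ⟨α, hα, hlt, hm⟩ := exists_inner_neg_of_mem_closure (γ := -γ) (ctx.pos_coords γ hγ)
    (by rw [inner_neg_left]; linarith [ctx.inner_self_pos hγΔ])
  rw [inner_neg_left, neg_lt_zero] at hlt
  have hd := ctx.sub_mem_of_inner_pos hγΔ (ctx.pos_subset (ctx.base_subset hα)) hlt
    (fun h => hb (h ▸ hα))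
  exact ⟨α, hα, ctx.pos_of_height_nonneg hd (ctx.height_nonneg hm)⟩

/-- Since the complement of the inversion set of `w` is closed under addition, the values of
positive roots on the cascade element are integers. -/
lemma inner_cascElt_mem {K : Finset V} (hK : ctx.IsCascade K) {w : V ≃ₗ[ℝ] V}
    (hw : w ∈ ctx.weylGroup)
    (hN : ∀ γ ∈ ctx.Pos,
      (-(w γ) ∈ ctx.Pos ↔ (⟪γ, cascElt K⟫ = 1 ∨ ⟪γ, cascElt K⟫ = 2)))
    {γ : V} (hγ : γ ∈ ctx.Pos) :
    ⟪γ, cascElt K⟫ = -1 ∨ ⟪γ, cascElt K⟫ = 0 ∨ ⟪γ, cascElt K⟫ = 1 ∨ ⟪γ, cascElt K⟫ = 2 := by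
  obtain ⟨n, hn, h1, h2⟩ := hK.exists_two_mul_inner_eq hγ
  obtain ⟨β, hβ, hin, hle⟩ := hK.exists_inner_pos hγ
  have hβv := hK.inner_self_cascElt hβ
  by_cases hγβ : γ = β
  · exact .inr (.inr (.inl (hγβ ▸ hβv)))
  have hβΔ := hK.subset_roots hβ
  have hd : β - γ ∈ ctx.Δ := ctx.sub_mem_of_inner_pos hβΔ (ctx.pos_subset hγ)
    (by rwa [real_inner_comm]) (Ne.symm hγβ)
  have hdp : β - γ ∈ ctx.Pos := ctx.pos_of_height_nonneg hd (ctx.height_nonneg hle)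
  have hβp : β ∈ ctx.Pos := by
    obtain ⟨S, hS⟩ := (hK β).1 hβ
    exact hS.isHighest.2.1
  have hodd : ¬ (n = -1 ∨ n = 1 ∨ n = 3) := fun hn' => by
    have hv : ⟪γ, cascElt K⟫ = -1 / 2 ∨ ⟪γ, cascElt K⟫ = 1 / 2 ∨ ⟪γ, cascElt K⟫ = 3 / 2 := by
      rcases hn' with rfl | rfl | rfl
      · left; push_cast at hn; linarith
      · right; left; push_cast at hn; linarith
      · right; right; push_cast at hn; linarith
    have hdv : ⟪β - γ, cascElt K⟫ = 1 - ⟪γ, cascElt K⟫ := by rw [inner_sub_left, hβv]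
    have hwγ : w γ ∈ ctx.Pos :=
      (ctx.pos_or_neg _ ((weylGroup_mem_roots_iff hw γ).2 (ctx.pos_subset hγ))).resolve_right
        fun h => by
          have := (hN γ hγ).1 h
          rcases hv with hv | hv | hv <;> rw [hv] at this <;> norm_num at this
    have hwd : w (β - γ) ∈ ctx.Pos :=
      (ctx.pos_or_neg _ ((weylGroup_mem_roots_iff hw _).2 hd)).resolve_right fun h => by
        have := (hN _ hdp).1 h
        rw [hdv] at this
        rcases hv with hv | hv | hv <;> rw [hv] at this <;> norm_num at this
    have hwβ := (hN β hβp).2 (.inl hβv)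
    have e1 := ctx.one_le_height hwγ
    have e2 := ctx.one_le_height hwd
    have e3 := ctx.one_le_height hwβ
    rw [map_neg] at e3
    rw [map_sub, map_sub] at e2
    linarith
  have : n = -2 ∨ n = 0 ∨ n = 2 ∨ n = 4 := by omega
  rcases this with rfl | rfl | rfl | rfl <;> push_cast at hn
  · left; linarith
  · right; left; linarith
  · right; right; left; linarith
  · right; right; right; linarith

/-- The form `⟪w⁻¹ ·, x_K⟫` is nonpositive on the positive cone, and the part of the cone where it
vanishes is sent into the positive cone by `w⁻¹`. -/
lemma inner_symm_nonpos {K : Finset V} (hK : ctx.IsCascade K) {w : V ≃ₗ[ℝ] V}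
    (hw : w ∈ ctx.weylGroup)
    (hN : ∀ γ ∈ ctx.Pos,
      (-(w γ) ∈ ctx.Pos ↔ (⟪γ, cascElt K⟫ = 1 ∨ ⟪γ, cascElt K⟫ = 2)))
    {y : V} (hy : y ∈ AddSubmonoid.closure (ctx.base : Set V)) :
    ⟪w.symm y, cascElt K⟫ ≤ 0 ∧ (⟪w.symm y, cascElt K⟫ = 0 →
      w.symm y ∈ AddSubmonoid.closure (ctx.base : Set V)) := by
  induction hy using AddSubmonoid.closure_induction with
  | mem b hb =>
    have hbp := ctx.base_subset hb
    have hg : w.symm b ∈ ctx.Δ :=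
      (weylGroup_mem_roots_iff hw _).1 (by rw [w.apply_symm_apply]; exact ctx.pos_subset hbp)
    rcases ctx.pos_or_neg _ hg with hp | hp
    · refine ⟨?_, fun _ => ctx.pos_coords _ hp⟩
      have hnot : ¬ (-(w (w.symm b)) ∈ ctx.Pos) := by
        rw [w.apply_symm_apply]
        exact ctx.pos_not_neg b hbp
      rw [hN _ hp, not_or] at hnot
      rcases inner_cascElt_mem hK hw hN hp with h | h | h | h
      · linarith
      · exact h.le
      · exact absurd h hnot.1
      · exact absurd h hnot.2
    · have h := (hN _ hp).1 (by rwa [map_neg, w.apply_symm_apply, neg_neg])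
      rw [inner_neg_left] at h
      have hlt : ⟪w.symm b, cascElt K⟫ < 0 := by rcases h with h | h <;> linarith
      exact ⟨hlt.le, fun h0 => absurd h0 hlt.ne⟩
  | zero => simp [zero_mem]
  | add a b _ _ iha ihb =>
    rw [map_add, inner_add_left]
    refine ⟨by linarith [iha.1, ihb.1], fun h => ?_⟩
    exact AddMemClass.add_mem (iha.2 (by linarith [iha.1, ihb.1])) (ihb.2 (by linarith [iha.1, ihb.1]))

end RootSystemCtx

/-- The minimal elements of the set of roots `Δ⟨K⟩` of the abelian ideal `a_K` are exactly
`w_K(Π_K(-1))`. -/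
theorem min_of_ideal {V : Type*} [NormedAddCommGroup V] [InnerProductSpace ℝ V]
    [FiniteDimensional ℝ V] (ctx : RootSystemCtx V)
    (K : Finset V) (hK : ctx.IsCascade K)
    (hA : ¬ ∃ p, 1 ≤ p ∧ ctx.IsTypeA (2 * p))
    (w : V ≃ₗ[ℝ] V) (hw : w ∈ ctx.weylGroup)
    (hN : ∀ γ ∈ ctx.Pos,
      (-(w γ) ∈ ctx.Pos ↔ (⟪γ, cascElt K⟫ = 1 ∨ ⟪γ, cascElt K⟫ = 2))) :
    ∀ δ : V,
      (δ ∈ ctx.idealSet w (cascElt K) ∧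
        ∀ δ' ∈ ctx.idealSet w (cascElt K), ctx.rootLE δ' δ → δ' = δ) ↔
      (∃ α ∈ ctx.base, ⟪α, cascElt K⟫ = -1 ∧ δ = w α) := by
  set x := cascElt K with hx
  have vals : ∀ γ ∈ ctx.Pos, ⟪γ, x⟫ = -1 ∨ ⟪γ, x⟫ = 0 ∨ ⟪γ, x⟫ = 1 ∨ ⟪γ, x⟫ = 2 :=
    fun γ hγ => RootSystemCtx.inner_cascElt_mem hK hw hN hγ
  have wpos : ∀ γ ∈ ctx.Pos, ⟪γ, x⟫ = 0 → w γ ∈ ctx.Pos := fun γ hγ h =>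
    (ctx.pos_or_neg _ ((RootSystemCtx.weylGroup_mem_roots_iff hw γ).2
      (ctx.pos_subset hγ))).resolve_right fun hn => by
        have := (hN γ hγ).1 hn
        rw [h] at this
        norm_num at this
  intro δ
  constructor
  · rintro ⟨⟨γ, hγ, ⟨hv, rfl⟩ | ⟨hv, rfl⟩⟩, hmin⟩
    · by_cases hb : γ ∈ ctx.base
      · exact ⟨γ, hb, hv, rfl⟩
      exfalso
      obtain ⟨α, hα, hαγ⟩ := RootSystemCtx.exists_base_sub_pos hγ hb
      have hαp := ctx.base_subset hα
      -- one summand has value `-1` and the other has value `0`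
      have split : ∀ a ∈ ctx.Pos, ∀ b ∈ ctx.Pos, γ = a + b → ⟪a, x⟫ = -1 → ⟪b, x⟫ = 0 →
          False := by
        intro a ha b hb hab h1 h2
        have hwb := wpos b hb h2
        have := hmin (w a) ⟨a, ha, .inl ⟨h1, rfl⟩⟩ (by
          rw [RootSystemCtx.rootLE, hab, map_add, add_sub_cancel_left]
          exact ctx.pos_coords _ hwb)
        rw [hab, map_add, left_eq_add] at this
        exact ctx.ne_zero_of_pos hwb this
      have hsum : ⟪α, x⟫ + ⟪γ - α, x⟫ = -1 := by rw [← inner_add_left, add_sub_cancel, hv]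
      rcases vals α hαp with h1 | h1 | h1 | h1
      · exact split α hαp _ hαγ (by abel) h1 (by linarith)
      · exact split _ hαγ α hαp (by abel) (by linarith) h1
      all_goals rcases vals _ hαγ with h2 | h2 | h2 | h2 <;> linarith
    · exfalso
      have hne : γ ≠ ctx.θ := fun h => by
        rw [h, hK.inner_self_cascElt hK.theta_mem] at hv
        norm_num at hv
      have hcone : ctx.θ - γ ∈ ctx.posCone ctx.Δ :=
        AddSubmonoid.closure_le.2 (fun b hb => RootSystemCtx.mem_posCone
          (ctx.pos_subset (ctx.base_subset hb)) (ctx.base_subset hb))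
          (ctx.theta_highest γ (ctx.pos_subset hγ))
      obtain ⟨q, hq, hqp, hγq, -⟩ := RootSystemCtx.closedSub_roots.exists_pos_add
        (ctx.pos_subset ctx.theta_mem) (ctx.pos_subset hγ) hγ hne hcone
      have hγqp : γ + q ∈ ctx.Pos := ctx.pos_of_height_nonneg hγq (by
        rw [map_add]
        linarith [ctx.one_le_height hγ, ctx.one_le_height hqp])
      have hsum : ⟪γ + q, x⟫ = 2 + ⟪q, x⟫ := by rw [inner_add_left, hv]
      have hcases : ⟪q, x⟫ = -1 ∨ ⟪q, x⟫ = 0 := by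
        rcases vals q hqp with h | h | h | h
        · exact .inl h
        · exact .inr h
        all_goals rcases vals _ hγqp with h' | h' | h' | h' <;> linarith
      rcases hcases with h | h
      · have hpos : -(w (γ + q)) ∈ ctx.Pos := (hN _ hγqp).2 (.inl (by linarith))
        have := hmin (w q) ⟨q, hqp, .inl ⟨h, rfl⟩⟩ (by
          rw [RootSystemCtx.rootLE, ← neg_add', ← map_add]
          exact ctx.pos_coords _ hpos)
        refine ctx.ne_zero_of_pos hpos ?_
        rw [map_add, this]
        simp
      · have hwq := wpos q hqp h
        have := hmin (-(w (γ + q))) ⟨γ + q, hγqp, .inr ⟨by linarith, rfl⟩⟩ (by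
          rw [RootSystemCtx.rootLE, map_add,
            show -(w γ) - -(w γ + w q) = w q by abel]
          exact ctx.pos_coords _ hwq)
        rw [neg_inj, map_add, add_eq_left] at this
        exact ctx.ne_zero_of_pos hwq this
  · rintro ⟨α, hα, hv, rfl⟩
    refine ⟨⟨α, ctx.base_subset hα, .inl ⟨hv, rfl⟩⟩, ?_⟩
    rintro δ' ⟨γ, hγ, ⟨hγv, rfl⟩ | ⟨hγv, rfl⟩⟩ hle
    · have h := (RootSystemCtx.inner_symm_nonpos hK hw hN hle).2
      rw [← map_sub, w.symm_apply_apply, inner_sub_left] at h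
      have h' := h (by rw [hv, hγv, sub_self])
      rcases ctx.height_of_mem_closure h' with h0 | h0
      · rw [sub_eq_zero.1 h0]
      · rw [map_sub, ctx.height_base hα] at h0
        linarith [ctx.one_le_height hγ]
    · exfalso
      have h := (RootSystemCtx.inner_symm_nonpos hK hw hN hle).1
      rw [sub_neg_eq_add, ← map_add, w.symm_apply_apply, inner_add_left] at h
      linarith
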